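/- For every partition Π of [0,T] and all (t,x) ∈ [0,T] × ℝ^d, the (almost surely constant) lower and upper value functions along Π satisfy V^Π(t,x) = sup_{α ∈ A^Π_{t,T}} inf_{β ∈ B^Π_{t,T}} E[g(X_T^{t,x,α,β})] and U^Π(t,x) = inf_{β ∈ B^Π_{t,T}} sup_{α ∈ A^Π_{t,T}} E[g(X_T^{t,x,α,β})]. -/

import Mathlib

open MeasureTheory Set Filter Topology
open scoped unitInterval RealInnerProductSpace ENNReal NNReal

noncomputable section

namespace DGameFormal

/-! ### The canonical sample space `Ω = ([0,1]²)^ℕ` -/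

/-- The sample space `Ω = ([0,1]²)^ℕ`.  The `j`-th coordinate mapping `ζ_{j+1}` of the paper is
`ω ↦ ω j` (we use `0`-based indexing, so the paper's `ζ_j`, `j ≥ 1`, is `ω ↦ ω (j-1)`). -/
abbrev Omega : Type := ℕ → (I × I)

/-- `𝓕_j`: the σ-field generated by the first `j` coordinate mappings `ζ_1, …, ζ_j`. -/
def Fsig (j : ℕ) : MeasurableSpace Omega :=
  MeasurableSpace.comap (fun ω (i : Fin j) => ω (i : ℕ)) inferInstance

/-- `𝓖_{j+1}`: the σ-field generated by the first component of the coordinate `ζ_{j+1}`. -/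
def Gsig (j : ℕ) : MeasurableSpace Omega :=
  MeasurableSpace.comap (fun ω => (ω j).1) inferInstance

/-- `𝓗_{j+1}`: the σ-field generated by the second component of the coordinate `ζ_{j+1}`. -/
def Hsig (j : ℕ) : MeasurableSpace Omega :=
  MeasurableSpace.comap (fun ω => (ω j).2) inferInstance

/-- `P` is the countable product `λ₂^{⊗ℕ}` of the two-dimensional Lebesgue (Borel) measure on the
unit square: it has the prescribed finite-dimensional distributions. -/
def IsProductMeasure (P : Measure Omega) : Prop :=
  ∀ m : ℕ, P.map (fun ω (i : Fin m) => ω (i : ℕ))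
      = Measure.pi (fun _ : Fin m => (volume : Measure (I × I)))

/-! ### Partitions of `[0,T]` -/

/-- A partition `0 = t_0 < t_1 < ⋯ < t_n = T` of the interval `[0,T]`. -/
structure Partition (T : ℝ) where
  n : ℕ
  npos : 0 < n
  t : ℕ → ℝ
  map_zero : t 0 = 0
  map_last : t n = T
  mono : ∀ i < n, t i < t (i + 1)

/-- The mesh `|Π|`: the maximal distance between two neighbouring points of the partition. -/
def Partition.mesh {T : ℝ} (π : Partition T) : ℝ :=
  (Finset.range π.n).sup' (Finset.nonempty_range_iff.2 π.npos.ne') fun i => π.t (i + 1) - π.t i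

open scoped Classical in
/-- For `t ∈ [t_i, t_{i+1})` the index `i` (and `n - 1` for `t ≥ t_{n-1}`). -/
def Partition.idx {T : ℝ} (π : Partition T) (s : ℝ) : ℕ :=
  Nat.findGreatest (fun i => π.t i ≤ s) (π.n - 1)

/-! ### Admissible controls along a partition -/

variable (U V : Type) [MeasurableSpace U] [MeasurableSpace V]

/-- Admissible controls for Player 1 along the partition `π`: measurable processes `u` such that on
each interval `[t_{j-1}, t_j)` of the partition, `u` is a countable sum `Σ_k 1_{Γ_{j,k}} u^{j,k}`
where `(Γ_{j,k})_k ⊆ 𝓕_{j-1}` is a partition of `Ω` and each `u^{j,k}` is `𝓖_j`-measurable. -/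
def AdmControl1 {T : ℝ} (π : Partition T) : Set (ℝ → Omega → U) :=
  {u | Measurable (Function.uncurry u) ∧
    ∀ j < π.n, ∃ (Γ : ℕ → Set Omega) (w : ℕ → ℝ → Omega → U),
      (∀ k, MeasurableSet[Fsig j] (Γ k)) ∧
      Pairwise (Function.onFun Disjoint Γ) ∧
      (⋃ k, Γ k) = univ ∧
      (∀ k s, Measurable[Gsig j] (w k s)) ∧
      (∀ k, ∀ ω ∈ Γ k, ∀ s ∈ Ico (π.t j) (π.t (j + 1)), u s ω = w k s ω)}

/-- Admissible controls for Player 2 along the partition `π` (with `𝓗_j` in place of `𝓖_j`). -/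
def AdmControl2 {T : ℝ} (π : Partition T) : Set (ℝ → Omega → V) :=
  {v | Measurable (Function.uncurry v) ∧
    ∀ j < π.n, ∃ (Γ : ℕ → Set Omega) (w : ℕ → ℝ → Omega → V),
      (∀ k, MeasurableSet[Fsig j] (Γ k)) ∧
      Pairwise (Function.onFun Disjoint Γ) ∧
      (⋃ k, Γ k) = univ ∧
      (∀ k s, Measurable[Hsig j] (w k s)) ∧
      (∀ k, ∀ ω ∈ Γ k, ∀ s ∈ Ico (π.t j) (π.t (j + 1)), v s ω = w k s ω)}

/-! ### Nonanticipative strategies with delay (NAD strategies) -/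

/-- A stopping time `τ : Ω → {0, 1, …, n-1}` of the discrete filtration `(𝓕_j)_j`. -/
def IsStoppingIdx {T : ℝ} (π : Partition T) (τ : Omega → ℕ) : Prop :=
  (∀ ω, τ ω < π.n) ∧ ∀ j, MeasurableSet[Fsig j] {ω | τ ω = j}

variable {U V}

/-- `u = u'`, `ds⊗dP`-a.e. on the stochastic interval `[[t, b]] = {(s,ω) | t ≤ s ≤ b ω}`. -/
def aeStEq {α : Type*} (P : Measure Omega) (t : ℝ) (b : Omega → ℝ)
    (u u' : ℝ → Omega → α) : Prop :=
  ∀ᵐ p ∂((volume : Measure ℝ).prod P), t ≤ p.1 → p.1 ≤ b p.2 → u p.1 p.2 = u' p.1 p.2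

/-- `u = u'`, `ds⊗dP`-a.e. on `[a,b] × Ω`. -/
def aeEqIcc {α : Type*} (P : Measure Omega) (a b : ℝ) (u u' : ℝ → Omega → α) : Prop :=
  ∀ᵐ p ∂((volume : Measure ℝ).prod P), p.1 ∈ Icc a b → u p.1 p.2 = u' p.1 p.2

variable (U V)

/-- NAD strategies for Player 1 on `[t,T]` along `π`: maps from admissible controls of Player 2 to
admissible controls of Player 1 such that controls agreeing `ds⊗dP`-a.e. on `[[t, t_τ]]`, for a
stopping time `τ`, are mapped to controls agreeing `ds⊗dP`-a.e. on `[[t, t_{τ+1}]]`. -/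
def IsNAD1 {T : ℝ} (P : Measure Omega) (π : Partition T) (t : ℝ)
    (α : (ℝ → Omega → V) → (ℝ → Omega → U)) : Prop :=
  (∀ v ∈ AdmControl2 V π, α v ∈ AdmControl1 U π) ∧
  ∀ τ : Omega → ℕ, IsStoppingIdx π τ →
    ∀ v v', v ∈ AdmControl2 V π → v' ∈ AdmControl2 V π →
      aeStEq P t (fun ω => π.t (τ ω)) v v' →
      aeStEq P t (fun ω => π.t (τ ω + 1)) (α v) (α v')

/-- NAD strategies for Player 2 on `[t,T]` along `π`. -/
def IsNAD2 {T : ℝ} (P : Measure Omega) (π : Partition T) (t : ℝ)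
    (β : (ℝ → Omega → U) → (ℝ → Omega → V)) : Prop :=
  (∀ u ∈ AdmControl1 U π, β u ∈ AdmControl2 V π) ∧
  ∀ τ : Omega → ℕ, IsStoppingIdx π τ →
    ∀ u u', u ∈ AdmControl1 U π → u' ∈ AdmControl1 U π →
      aeStEq P t (fun ω => π.t (τ ω)) u u' →
      aeStEq P t (fun ω => π.t (τ ω + 1)) (β u) (β u')

/-! ### The controlled dynamics -/

variable {U V}
variable {d : ℕ}

/-- `X` is the (continuous) solution on `[t,T]` of `X_s = x + ∫_t^s f(r, X_r, u_r, v_r) dr`. -/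
def IsSol (f : ℝ → EuclideanSpace ℝ (Fin d) → U → V → EuclideanSpace ℝ (Fin d)) (T t : ℝ)
    (x : EuclideanSpace ℝ (Fin d)) (u : ℝ → U) (v : ℝ → V)
    (X : ℝ → EuclideanSpace ℝ (Fin d)) : Prop :=
  ContinuousOn X (Icc t T) ∧ ∀ s ∈ Icc t T, X s = x + ∫ r in t..s, f r (X r) (u r) (v r)

/-- The solution `X^{t,x,u,v}` (chosen via the axiom of choice; under the standing assumptions it
is the unique continuous solution). -/
def sol (f : ℝ → EuclideanSpace ℝ (Fin d) → U → V → EuclideanSpace ℝ (Fin d)) (T t : ℝ)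
    (x : EuclideanSpace ℝ (Fin d)) (u : ℝ → U) (v : ℝ → V) : ℝ → EuclideanSpace ℝ (Fin d) :=
  Classical.epsilon (IsSol f T t x u v)

/-- `(u,v)` is the couple of admissible controls associated with the couple of NAD strategies
`(α,β)` on `[t, tl]`:  `α(v) = u` and `β(u) = v`, `ds⊗dP`-a.e. on `[t,tl] × Ω`. -/
def IsFixPair {T : ℝ} (P : Measure Omega) (π : Partition T) (t tl : ℝ)
    (α : (ℝ → Omega → V) → (ℝ → Omega → U)) (β : (ℝ → Omega → U) → (ℝ → Omega → V))
    (u : ℝ → Omega → U) (v : ℝ → Omega → V) : Prop :=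
  u ∈ AdmControl1 U π ∧ v ∈ AdmControl2 V π ∧ aeEqIcc P t tl (α v) u ∧ aeEqIcc P t tl (β u) v

variable [Nonempty U] [Nonempty V]

/-- The couple of admissible controls associated with a couple of NAD strategies on `[t,tl]`
(chosen via the axiom of choice; by Lemma 2.1 it exists and is `ds⊗dP`-a.e. unique). -/
def fixPair {T : ℝ} (P : Measure Omega) (π : Partition T) (t tl : ℝ)
    (α : (ℝ → Omega → V) → (ℝ → Omega → U)) (β : (ℝ → Omega → U) → (ℝ → Omega → V)) :
    (ℝ → Omega → U) × (ℝ → Omega → V) :=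
  Classical.epsilon fun p => IsFixPair P π t tl α β p.1 p.2

/-- The state process `X^{t,x,α,β}` associated with a couple of NAD strategies on `[t,tl]`. -/
def solStrat (f : ℝ → EuclideanSpace ℝ (Fin d) → U → V → EuclideanSpace ℝ (Fin d)) {T : ℝ}
    (P : Measure Omega) (π : Partition T) (t tl : ℝ) (x : EuclideanSpace ℝ (Fin d))
    (α : (ℝ → Omega → V) → (ℝ → Omega → U)) (β : (ℝ → Omega → U) → (ℝ → Omega → V))
    (s : ℝ) (ω : Omega) : EuclideanSpace ℝ (Fin d) :=
  sol f T t x (fun r => (fixPair P π t tl α β).1 r ω) (fun r => (fixPair P π t tl α β).2 r ω) s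

/-- The terminal pay-off `g(X_T^{t,x,α,β})`. -/
def payoff (f : ℝ → EuclideanSpace ℝ (Fin d) → U → V → EuclideanSpace ℝ (Fin d))
    (g : EuclideanSpace ℝ (Fin d) → ℝ) {T : ℝ} (P : Measure Omega) (π : Partition T)
    (t : ℝ) (x : EuclideanSpace ℝ (Fin d))
    (α : (ℝ → Omega → V) → (ℝ → Omega → U)) (β : (ℝ → Omega → U) → (ℝ → Omega → V)) :
    Omega → ℝ :=
  fun ω => g (solStrat f P π t T x α β T ω)

/-! ### Essential suprema/infima of families of random variables -/

/-- `S` is the `P`-a.s. least upper bound of the family `(ξ_i)_{i}` of random variables. -/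
def IsEssSupFam {ι : Sort*} (P : Measure Omega) (ξ : ι → Omega → ℝ) (S : Omega → ℝ) : Prop :=
  (∀ i, ξ i ≤ᵐ[P] S) ∧ ∀ W : Omega → ℝ, (∀ i, ξ i ≤ᵐ[P] W) → S ≤ᵐ[P] W

/-- `S` is the `P`-a.s. greatest lower bound of the family `(ξ_i)_{i}` of random variables. -/
def IsEssInfFam {ι : Sort*} (P : Measure Omega) (ξ : ι → Omega → ℝ) (S : Omega → ℝ) : Prop :=
  (∀ i, S ≤ᵐ[P] ξ i) ∧ ∀ W : Omega → ℝ, (∀ i, W ≤ᵐ[P] ξ i) → W ≤ᵐ[P] S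

/-! ### Value functions along a partition -/

variable (U V)

/-- The defining property of the lower value function along `π`:
`S = esssup_{α} essinf_{β} E[g(X_T^{t,x,α,β}) | 𝓕_i]` for `t_i ≤ t < t_{i+1}`. -/
def IsLowerVal (f : ℝ → EuclideanSpace ℝ (Fin d) → U → V → EuclideanSpace ℝ (Fin d))
    (g : EuclideanSpace ℝ (Fin d) → ℝ) {T : ℝ} (P : Measure Omega) (π : Partition T)
    (t : ℝ) (x : EuclideanSpace ℝ (Fin d)) (S : Omega → ℝ) : Prop :=
  ∃ J : {α // IsNAD1 U V P π t α} → Omega → ℝ,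
    (∀ α, IsEssInfFam P
      (fun β : {β // IsNAD2 U V P π t β} => P[payoff f g P π t x α.1 β.1 | Fsig (π.idx t)])
      (J α)) ∧
    IsEssSupFam P J S

/-- The defining property of the upper value function along `π`. -/
def IsUpperVal (f : ℝ → EuclideanSpace ℝ (Fin d) → U → V → EuclideanSpace ℝ (Fin d))
    (g : EuclideanSpace ℝ (Fin d) → ℝ) {T : ℝ} (P : Measure Omega) (π : Partition T)
    (t : ℝ) (x : EuclideanSpace ℝ (Fin d)) (S : Omega → ℝ) : Prop :=
  ∃ J : {β // IsNAD2 U V P π t β} → Omega → ℝ,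
    (∀ β, IsEssSupFam P
      (fun α : {α // IsNAD1 U V P π t α} => P[payoff f g P π t x α.1 β.1 | Fsig (π.idx t)])
      (J β)) ∧
    IsEssInfFam P J S

/-- The lower value function along `π` seen as a random variable. -/
def lowerVal (f : ℝ → EuclideanSpace ℝ (Fin d) → U → V → EuclideanSpace ℝ (Fin d))
    (g : EuclideanSpace ℝ (Fin d) → ℝ) {T : ℝ} (P : Measure Omega) (π : Partition T)
    (t : ℝ) (x : EuclideanSpace ℝ (Fin d)) : Omega → ℝ :=
  Classical.epsilon (IsLowerVal U V f g P π t x)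

/-- The upper value function along `π` seen as a random variable. -/
def upperVal (f : ℝ → EuclideanSpace ℝ (Fin d) → U → V → EuclideanSpace ℝ (Fin d))
    (g : EuclideanSpace ℝ (Fin d) → ℝ) {T : ℝ} (P : Measure Omega) (π : Partition T)
    (t : ℝ) (x : EuclideanSpace ℝ (Fin d)) : Omega → ℝ :=
  Classical.epsilon (IsUpperVal U V f g P π t x)

/-- The (deterministic) lower value function along `π`: the expectation of `lowerVal`. -/
def lowerValD (f : ℝ → EuclideanSpace ℝ (Fin d) → U → V → EuclideanSpace ℝ (Fin d))
    (g : EuclideanSpace ℝ (Fin d) → ℝ) {T : ℝ} (P : Measure Omega) (π : Partition T)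
    (t : ℝ) (x : EuclideanSpace ℝ (Fin d)) : ℝ :=
  ∫ ω, lowerVal U V f g P π t x ω ∂P

/-- The (deterministic) upper value function along `π`: the expectation of `upperVal`. -/
def upperValD (f : ℝ → EuclideanSpace ℝ (Fin d) → U → V → EuclideanSpace ℝ (Fin d))
    (g : EuclideanSpace ℝ (Fin d) → ℝ) {T : ℝ} (P : Measure Omega) (π : Partition T)
    (t : ℝ) (x : EuclideanSpace ℝ (Fin d)) : ℝ :=
  ∫ ω, upperVal U V f g P π t x ω ∂P

/-! ### The Hamiltonian and viscosity solutions -/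

section Hamiltonian

variable (U V : Type) [MetricSpace U] [MetricSpace V] [MeasurableSpace U] [MeasurableSpace V]

/-- `f̃(t,x,μ,ν) = ∫_U ∫_V f(t,x,u,v) μ(du) ν(dv)` for mixed actions `μ ∈ Δ(U)`, `ν ∈ Δ(V)`. -/
def ftilde (f : ℝ → EuclideanSpace ℝ (Fin d) → U → V → EuclideanSpace ℝ (Fin d))
    (t : ℝ) (x : EuclideanSpace ℝ (Fin d)) (μ : ProbabilityMeasure U) (ν : ProbabilityMeasure V) :
    EuclideanSpace ℝ (Fin d) :=
  ∫ u, ∫ v, f t x u v ∂(ν : Measure V) ∂(μ : Measure U)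

/-- The Hamiltonian `sup_{μ ∈ ΔU} inf_{ν ∈ ΔV} f̃(t,x,μ,ν)·p`. -/
def ham (f : ℝ → EuclideanSpace ℝ (Fin d) → U → V → EuclideanSpace ℝ (Fin d))
    (t : ℝ) (x p : EuclideanSpace ℝ (Fin d)) : ℝ :=
  ⨆ μ : ProbabilityMeasure U, ⨅ ν : ProbabilityMeasure V, ⟪ftilde U V f t x μ ν, p⟫

/-- Viscosity subsolution of `∂_t W + sup_μ inf_ν f̃(t,x,μ,ν)·∇W = 0`, `W(T,·) = g`, on
`[0,T] × ℝ^d`. -/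
def IsViscSubsol (f : ℝ → EuclideanSpace ℝ (Fin d) → U → V → EuclideanSpace ℝ (Fin d))
    (g : EuclideanSpace ℝ (Fin d) → ℝ) (T : ℝ) (W : ℝ → EuclideanSpace ℝ (Fin d) → ℝ) : Prop :=
  (∀ x, W T x ≤ g x) ∧
  ∀ φ : ℝ → EuclideanSpace ℝ (Fin d) → ℝ,
    ContDiff ℝ 1 (fun q : ℝ × EuclideanSpace ℝ (Fin d) => φ q.1 q.2) →
    ∀ t x, t ∈ Ico (0 : ℝ) T →
      IsLocalMaxOn (fun q : ℝ × EuclideanSpace ℝ (Fin d) => W q.1 q.2 - φ q.1 q.2)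
        (Icc (0 : ℝ) T ×ˢ univ) (t, x) →
      0 ≤ deriv (fun s => φ s x) t + ham U V f t x (gradient (fun y => φ t y) x)

/-- Viscosity supersolution of `∂_t W + sup_μ inf_ν f̃(t,x,μ,ν)·∇W = 0`, `W(T,·) = g`, on
`[0,T] × ℝ^d`. -/
def IsViscSupersol (f : ℝ → EuclideanSpace ℝ (Fin d) → U → V → EuclideanSpace ℝ (Fin d))
    (g : EuclideanSpace ℝ (Fin d) → ℝ) (T : ℝ) (W : ℝ → EuclideanSpace ℝ (Fin d) → ℝ) : Prop :=
  (∀ x, g x ≤ W T x) ∧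
  ∀ φ : ℝ → EuclideanSpace ℝ (Fin d) → ℝ,
    ContDiff ℝ 1 (fun q : ℝ × EuclideanSpace ℝ (Fin d) => φ q.1 q.2) →
    ∀ t x, t ∈ Ico (0 : ℝ) T →
      IsLocalMinOn (fun q : ℝ × EuclideanSpace ℝ (Fin d) => W q.1 q.2 - φ q.1 q.2)
        (Icc (0 : ℝ) T ×ˢ univ) (t, x) →
      deriv (fun s => φ s x) t + ham U V f t x (gradient (fun y => φ t y) x) ≤ 0

end Hamiltonian

/-! ### Carathéodory differential equations -/

section Caratheodory

lemma intervalIntegrable_comp_of_continuousOn {E : Type*} [NormedAddCommGroup E]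
    [MeasurableSpace E] [BorelSpace E] [SecondCountableTopology E] {h : ℝ → E → E} {C t s : ℝ}
    (hm : Measurable (Function.uncurry h)) (hC : ∀ r y, ‖h r y‖ ≤ C) (hts : t ≤ s)
    {A : ℝ → E} (hA : ContinuousOn A (Icc t s)) :
    IntervalIntegrable (fun r => h r (A r)) volume t s := by
  rw [intervalIntegrable_iff_integrableOn_Ioc_of_le hts]
  have hA' : AEMeasurable A (volume.restrict (Ioc t s)) :=
    (hA.mono Ioc_subset_Icc_self).aemeasurable measurableSet_Ioc
  exact Integrable.of_bound (C := C)
    (hm.comp_aemeasurable (aemeasurable_id.prodMk hA')).aestronglyMeasurable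
    (ae_of_all _ fun r => hC r _)

variable {E : Type*} [NormedAddCommGroup E] [NormedSpace ℝ E]

/-- Picard iterates of the integral equation `X_s = x + ∫_t^s h(r, X_r) dr`. -/
def picard (t : ℝ) (x : E) (h : ℝ → E → E) : ℕ → ℝ → E
  | 0 => fun _ => x
  | n + 1 => fun s => x + ∫ r in t..s, h r (picard t x h n r)

lemma norm_integral_le_of_bound {h : ℝ → E → E} {C t T : ℝ} (hC : ∀ r y, ‖h r y‖ ≤ C) {s : ℝ}
    (hs : s ∈ Icc t T) (A : ℝ → E) : ‖∫ r in t..s, h r (A r)‖ ≤ C * (T - t) := by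
  have h0 : 0 ≤ C := (norm_nonneg _).trans (hC 0 0)
  refine (intervalIntegral.norm_integral_le_of_norm_le_const fun r _ => hC r (A r)).trans ?_
  rw [abs_of_nonneg (sub_nonneg.2 hs.1)]
  exact mul_le_mul_of_nonneg_left (by linarith [hs.2]) h0

variable [MeasurableSpace E] [BorelSpace E] [SecondCountableTopology E]

lemma norm_integral_sub_le_picard_bound {h : ℝ → E → E} {C t s D : ℝ} {K : ℝ≥0}
    (hm : Measurable (Function.uncurry h)) (hC : ∀ r y, ‖h r y‖ ≤ C)
    (hK : ∀ r, LipschitzWith K (h r)) (hts : t ≤ s) {A B : ℝ → E}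
    (hA : ContinuousOn A (Icc t s)) (hB : ContinuousOn B (Icc t s)) (n : ℕ)
    (hAB : ∀ r ∈ Icc t s, ‖A r - B r‖ ≤ D * ((K * (r - t)) ^ n / n.factorial)) :
    ‖(∫ r in t..s, h r (A r)) - ∫ r in t..s, h r (B r)‖
      ≤ D * ((K * (s - t)) ^ (n + 1) / (n + 1).factorial) := by
  rw [← intervalIntegral.integral_sub (intervalIntegrable_comp_of_continuousOn hm hC hts hA)
    (intervalIntegrable_comp_of_continuousOn hm hC hts hB)]
  have hint : ∫ r in t..s, K * (D * ((K * (r - t)) ^ n / n.factorial))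
      = D * ((K * (s - t)) ^ (n + 1) / (n + 1).factorial) := by
    have : (fun r : ℝ => (K : ℝ) * (D * ((K * (r - t)) ^ n / n.factorial)))
        = fun r => (K ^ (n + 1) * D / n.factorial) * (r - t) ^ n := by
      funext r; rw [mul_pow]; ring
    rw [this, intervalIntegral.integral_const_mul,
      intervalIntegral.integral_comp_sub_right (fun r => r ^ n) t, integral_pow,
      Nat.factorial_succ]
    have h1 : (n.factorial : ℝ) ≠ 0 := by positivity
    have h2 : (n : ℝ) + 1 ≠ 0 := by positivity
    push_cast
    field_simp
    simp only [sub_self, mul_pow, ne_eq, Nat.add_eq_zero_iff, one_ne_zero, and_false,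
      not_false_eq_true, zero_pow]
    ring
  rw [← hint]
  refine intervalIntegral.norm_integral_le_of_norm_le hts (ae_of_all _ fun r hr => ?_)
    (Continuous.intervalIntegrable (by fun_prop) _ _)
  have := (hK r).norm_sub_le (A r) (B r)
  exact this.trans (mul_le_mul_of_nonneg_left (hAB r (Ioc_subset_Icc_self hr)) K.2)

variable {h : ℝ → E → E} {C t T : ℝ} {K : ℝ≥0} {x : E}

lemma continuous_picard (hm : Measurable (Function.uncurry h)) (hC : ∀ r y, ‖h r y‖ ≤ C)
    (n : ℕ) : Continuous (picard t x h n) := by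
  induction n with
  | zero => exact continuous_const
  | succ n ih =>
    refine continuous_const.add (intervalIntegral.continuous_primitive (fun a b => ?_) t)
    rcases le_total a b with hab | hab
    · exact intervalIntegrable_comp_of_continuousOn hm hC hab ih.continuousOn
    · exact (intervalIntegrable_comp_of_continuousOn hm hC hab ih.continuousOn).symm

/-- Picard iterates converge to every solution. -/
lemma tendsto_picard (hm : Measurable (Function.uncurry h)) (hC : ∀ r y, ‖h r y‖ ≤ C)
    (hK : ∀ r, LipschitzWith K (h r)) {X : ℝ → E} (hX : ContinuousOn X (Icc t T))
    (hXe : ∀ s ∈ Icc t T, X s = x + ∫ r in t..s, h r (X r)) {s : ℝ} (hs : s ∈ Icc t T) :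
    Tendsto (fun n => picard t x h n s) atTop (𝓝 (X s)) := by
  have key : ∀ n, ∀ s ∈ Icc t T,
      ‖X s - picard t x h n s‖ ≤ C * (T - t) * ((K * (s - t)) ^ n / n.factorial) := by
    intro n
    induction n with
    | zero =>
      intro s hs
      rw [hXe s hs]
      simpa [picard] using norm_integral_le_of_bound hC hs X
    | succ n ih =>
      intro s hs
      have hsub : Icc t s ⊆ Icc t T := Icc_subset_Icc_right hs.2
      have h1 := norm_integral_sub_le_picard_bound hm hC hK hs.1 (hX.mono hsub)
        (continuous_picard (t := t) (x := x) hm hC n).continuousOn n fun r hr => ih r (hsub hr)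
      rw [hXe s hs]
      simpa [picard] using h1
  rw [tendsto_iff_norm_sub_tendsto_zero]
  refine squeeze_zero (g := fun n : ℕ => C * (T - t) * ((K * (s - t)) ^ n / n.factorial))
    (fun _ => norm_nonneg _) (fun n => by rw [norm_sub_rev]; exact key n s hs) ?_
  simpa using ((Real.summable_pow_div_factorial (K * (s - t))).tendsto_atTop_zero).const_mul
    (C * (T - t))

/-- Existence of a solution of the integral equation. -/
lemma exists_integral_solution [CompleteSpace E] (hm : Measurable (Function.uncurry h))
    (hC : ∀ r y, ‖h r y‖ ≤ C) (hK : ∀ r, LipschitzWith K (h r)) :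
    ∃ X : ℝ → E, ContinuousOn X (Icc t T) ∧
      ∀ s ∈ Icc t T, X s = x + ∫ r in t..s, h r (X r) := by
  have h0 : 0 ≤ C := (norm_nonneg _).trans (hC 0 x)
  have key : ∀ n, ∀ s ∈ Icc t T, ‖picard t x h (n + 1) s - picard t x h n s‖
      ≤ C * (T - t) * ((K * (s - t)) ^ n / n.factorial) := by
    intro n
    induction n with
    | zero =>
      intro s hs
      simpa [picard] using norm_integral_le_of_bound hC hs fun _ => x
    | succ n ih =>
      intro s hs
      have hsub : Icc t s ⊆ Icc t T := Icc_subset_Icc_right hs.2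
      have h1 := norm_integral_sub_le_picard_bound hm hC hK hs.1
        (continuous_picard (t := t) (x := x) hm hC (n + 1)).continuousOn
        (continuous_picard (t := t) (x := x) hm hC n).continuousOn n fun r hr => ih r (hsub hr)
      simpa [picard] using h1
  have hlim : ∀ s, ∃ y, s ∈ Icc t T → Tendsto (fun n => picard t x h n s) atTop (𝓝 y) := by
    intro s
    by_cases hs : s ∈ Icc t T
    · have : CauchySeq fun n => picard t x h n s := by
        refine cauchySeq_of_dist_le_of_summable _ (fun n => ?_)
          ((Real.summable_pow_div_factorial (K * (s - t))).mul_left (C * (T - t)))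
        rw [dist_comm, dist_eq_norm]
        exact key n s hs
      obtain ⟨y, hy⟩ := cauchySeq_tendsto_of_complete this
      exact ⟨y, fun _ => hy⟩
    · exact ⟨x, fun h => absurd h hs⟩
  choose X hX using hlim
  refine ⟨X, ?_, fun s hs => ?_⟩
  · have hLip : LipschitzOnWith (Real.toNNReal C) X (Icc t T) := by
      refine LipschitzOnWith.of_dist_le_mul fun a ha b hb => ?_
      rw [Real.coe_toNNReal _ h0]
      refine le_of_tendsto (((hX a ha).comp (tendsto_add_atTop_nat 1)).dist
        ((hX b hb).comp (tendsto_add_atTop_nat 1))) (Eventually.of_forall fun n => ?_)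
      have hi : ∀ s ∈ Icc t T, IntervalIntegrable (fun r => h r (picard t x h n r)) volume t s :=
        fun s hs => intervalIntegrable_comp_of_continuousOn hm hC hs.1
          (continuous_picard hm hC n).continuousOn
      simp only [Function.comp, picard, dist_add_left]
      rw [dist_eq_norm, intervalIntegral.integral_interval_sub_left (hi a ha) (hi b hb), Real.dist_eq]
      exact intervalIntegral.norm_integral_le_of_norm_le_const fun r _ => hC r _
    exact hLip.continuousOn
  · refine tendsto_nhds_unique ((hX s hs).comp (tendsto_add_atTop_nat 1)) ?_
    refine Tendsto.const_add x (intervalIntegral.tendsto_integral_filter_of_dominated_convergence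
      (fun _ => C) (Eventually.of_forall fun n => ?_)
      (Eventually.of_forall fun n => ae_of_all _ fun r _ => hC r _) (by simp)
      (ae_of_all _ fun r hr => ?_))
    · exact (hm.comp (measurable_id.prodMk
        (continuous_picard hm hC n).measurable)).aestronglyMeasurable
    · rw [uIoc_of_le hs.1] at hr
      exact ((hK r).continuous.tendsto _).comp (hX r ⟨hr.1.le, hr.2.trans hs.2⟩)

/-- Picard iterates depend measurably on a parameter. -/
lemma measurable_picard_param {Ω : Type*} [MeasurableSpace Ω] {H : Ω → ℝ → E → E}
    (hm : Measurable fun q : Ω × ℝ × E => H q.1 q.2.1 q.2.2)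
    (hC : ∀ ω r y, ‖H ω r y‖ ≤ C) (n : ℕ) :
    Measurable fun q : Ω × ℝ => picard t x (H q.1) n q.2 := by
  have hω : ∀ ω, Measurable (Function.uncurry (H ω)) := fun ω =>
    hm.comp (measurable_const.prodMk measurable_id)
  induction n with
  | zero => exact measurable_const
  | succ n ih =>
    have hflip : Measurable (Function.uncurry fun (s : ℝ) (ω : Ω) =>
        picard t x (H ω) (n + 1) s) := by
      refine measurable_uncurry_of_continuous_of_measurable
        (fun ω => continuous_picard (hω ω) (hC ω) (n + 1)) fun s => ?_
      have hj : StronglyMeasurable (Function.uncurry fun (ω : Ω) (r : ℝ) =>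
          H ω r (picard t x (H ω) n r)) :=
        (hm.comp (measurable_fst.prodMk (measurable_snd.prodMk ih))).stronglyMeasurable
      refine measurable_const.add ?_
      simp only [intervalIntegral]
      exact (hj.integral_prod_right.sub hj.integral_prod_right).measurable
    exact hflip.comp measurable_swap

end Caratheodory

/-- The terminal state depends measurably on jointly measurable controls. -/
lemma measurable_sol {Ω U V : Type} [MeasurableSpace Ω] [TopologicalSpace U] [TopologicalSpace V]
    [SecondCountableTopology U] [SecondCountableTopology V]
    [MeasurableSpace U] [BorelSpace U] [MeasurableSpace V] [BorelSpace V] {T : ℝ} (hT : 0 ≤ T)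
    {f : ℝ → EuclideanSpace ℝ (Fin d) → U → V → EuclideanSpace ℝ (Fin d)} {C : ℝ} {K : ℝ≥0}
    (hf_bdd : ∀ t x u v, ‖f t x u v‖ ≤ C)
    (hf_cont : ContinuousOn
      (fun q : ℝ × EuclideanSpace ℝ (Fin d) × U × V => f q.1 q.2.1 q.2.2.1 q.2.2.2)
      (Icc (0 : ℝ) T ×ˢ univ))
    (hf_lip : ∀ t u v, LipschitzWith K fun x => f t x u v)
    {t : ℝ} (ht : t ∈ Icc (0 : ℝ) T) (x : EuclideanSpace ℝ (Fin d))
    {u : ℝ → Ω → U} {v : ℝ → Ω → V} (hu : Measurable (Function.uncurry u))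
    (hv : Measurable (Function.uncurry v)) :
    Measurable fun ω => sol f T t x (fun r => u r ω) (fun r => v r ω) T := by
  let p : ℝ → ℝ := fun r => projIcc 0 T hT r
  have hp : ∀ r ∈ Icc 0 T, p r = r := fun r hr => by simp [p, projIcc_of_mem hT hr]
  have hF : Continuous
      fun q : ℝ × EuclideanSpace ℝ (Fin d) × U × V => f (p q.1) q.2.1 q.2.2.1 q.2.2.2 := by
    refine hf_cont.comp_continuous (f := fun q : ℝ × EuclideanSpace ℝ (Fin d) × U × V =>
      (p q.1, q.2)) ?_ fun q => ⟨(projIcc 0 T hT q.1).2, mem_univ _⟩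
    exact ((continuous_subtype_val.comp continuous_projIcc).comp continuous_fst).prodMk
      continuous_snd
  let H : Ω → ℝ → EuclideanSpace ℝ (Fin d) → EuclideanSpace ℝ (Fin d) :=
    fun ω r y => f (p r) y (u r ω) (v r ω)
  have hH : Measurable fun q : Ω × ℝ × EuclideanSpace ℝ (Fin d) => H q.1 q.2.1 q.2.2 := by
    have hu' : Measurable fun q : Ω × ℝ × EuclideanSpace ℝ (Fin d) => u q.2.1 q.1 :=
      hu.comp (measurable_snd.fst.prodMk measurable_fst)
    have hv' : Measurable fun q : Ω × ℝ × EuclideanSpace ℝ (Fin d) => v q.2.1 q.1 :=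
      hv.comp (measurable_snd.fst.prodMk measurable_fst)
    exact hF.measurable.comp (measurable_snd.fst.prodMk
      (measurable_snd.snd.prodMk (hu'.prodMk hv')))
  have hHω : ∀ ω, Measurable (Function.uncurry (H ω)) := fun ω =>
    hH.comp (measurable_const.prodMk measurable_id)
  have hC : ∀ ω r y, ‖H ω r y‖ ≤ C := fun ω r y => hf_bdd _ _ _ _
  have hK : ∀ ω r, LipschitzWith K (H ω r) := fun ω r => hf_lip _ _ _
  have hsol : ∀ ω X, IsSol f T t x (fun r => u r ω) (fun r => v r ω) X ↔
      (ContinuousOn X (Icc t T) ∧ ∀ s ∈ Icc t T, X s = x + ∫ r in t..s, H ω r (X r)) := by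
    intro ω X
    refine and_congr_right fun _ => forall₂_congr fun s hs => ?_
    have : ∫ r in t..s, f r (X r) (u r ω) (v r ω) = ∫ r in t..s, H ω r (X r) := by
      refine intervalIntegral.integral_congr fun r hr => ?_
      rw [uIcc_of_le hs.1] at hr
      simp only [H, hp r ⟨ht.1.trans hr.1, hr.2.trans hs.2⟩]
    rw [this]
  refine measurable_of_tendsto_metrizable
    (f := fun n ω => picard t x (H ω) n T) (fun n => ?_) (tendsto_pi_nhds.2 fun ω => ?_)
  · exact (measurable_picard_param hH hC n).comp (measurable_id.prodMk measurable_const)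
  · have hex : ∃ X, IsSol f T t x (fun r => u r ω) (fun r => v r ω) X := by
      obtain ⟨X, hX⟩ := exists_integral_solution (t := t) (T := T) (x := x)
        (hHω ω) (hC ω) (hK ω)
      exact ⟨X, (hsol ω X).2 hX⟩
    obtain ⟨h1, h2⟩ := (hsol ω _).1 (Classical.epsilon_spec hex)
    exact tendsto_picard (hHω ω) (hC ω) (hK ω) h1 h2 ⟨ht.2, le_rfl⟩

/-- The state process only depends on the `ds`-a.e. class of the controls. -/
lemma sol_congr {U V : Type} {T t : ℝ}
    {f : ℝ → EuclideanSpace ℝ (Fin d) → U → V → EuclideanSpace ℝ (Fin d)}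
    {x : EuclideanSpace ℝ (Fin d)} {u u' : ℝ → U} {v v' : ℝ → V}
    (h : ∀ᵐ s, s ∈ Icc t T → u s = u' s ∧ v s = v' s) :
    sol f T t x u v = sol f T t x u' v' := by
  have : IsSol f T t x u v = IsSol f T t x u' v' := by
    funext X
    refine propext (and_congr_right fun _ => forall₂_congr fun s hs => ?_)
    have : ∫ r in t..s, f r (X r) (u r) (v r) = ∫ r in t..s, f r (X r) (u' r) (v' r) := by
      refine intervalIntegral.integral_congr_ae ?_
      filter_upwards [h] with r hr hrs
      rw [uIoc_of_le hs.1] at hrs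
      obtain ⟨h1, h2⟩ := hr ⟨hrs.1.le, hrs.2.trans hs.2⟩
      rw [h1, h2]
    rw [this]
  unfold sol
  rw [this]

/-! ### Essential suprema of families with the pasting property -/

section EssSup

variable {P : Measure Omega} {ι : Type*} {i : ℕ}

lemma fsig_le (i : ℕ) : Fsig i ≤ (inferInstance : MeasurableSpace Omega) :=
  Measurable.comap_le (measurable_pi_lambda _ fun _ => measurable_pi_apply _)

lemma isEssInfFam_iff_neg {ξ : ι → Omega → ℝ} {S : Omega → ℝ} :
    IsEssInfFam P ξ S ↔ IsEssSupFam P (fun a => -ξ a) (-S) := by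
  refine and_congr (forall_congr' fun a => ?_) ⟨fun h W hW => ?_, fun h W hW => ?_⟩
  · exact ⟨fun h => h.mono fun ω hω => neg_le_neg hω,
      fun h => h.mono fun ω hω => neg_le_neg_iff.1 hω⟩
  · exact (h (-W) fun a => (hW a).mono fun ω hω => neg_le.1 hω).mono fun ω hω => neg_le.1 hω
  · exact (h (-W) fun a => (hW a).mono fun ω hω => neg_le_neg hω).mono
      fun ω hω => neg_le_neg_iff.1 hω

lemma IsEssSupFam.ae_le_on {ξ ξ' : ι → Omega → ℝ} {S S' : Omega → ℝ} {A : Set Omega}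
    (h : IsEssSupFam P ξ S) (h' : IsEssSupFam P ξ' S')
    (he : ∀ a, ∀ᵐ ω ∂P, ω ∈ A → ξ a ω = ξ' a ω) : ∀ᵐ ω ∂P, ω ∈ A → S ω ≤ S' ω := by
  classical
  filter_upwards [h.2 (A.piecewise S' S) fun a => by
    filter_upwards [h.1 a, h'.1 a, he a] with ω h1 h2 h3
    by_cases hω : ω ∈ A
    · simpa [hω, h3 hω] using h2
    · simpa [hω] using h1] with ω hω hA
  simpa [hA] using hω

/-- The essential supremum is local. -/
lemma IsEssSupFam.ae_eq_on {ξ ξ' : ι → Omega → ℝ} {S S' : Omega → ℝ} {A : Set Omega}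
    (h : IsEssSupFam P ξ S) (h' : IsEssSupFam P ξ' S')
    (he : ∀ a, ∀ᵐ ω ∂P, ω ∈ A → ξ a ω = ξ' a ω) : ∀ᵐ ω ∂P, ω ∈ A → S ω = S' ω := by
  filter_upwards [h.ae_le_on h' he, h'.ae_le_on h fun a => (he a).mono fun ω hω hA => (hω hA).symm]
    with ω h1 h2 hA using le_antisymm (h1 hA) (h2 hA)

/-- The essential infimum is local. -/
lemma IsEssInfFam.ae_eq_on {ξ ξ' : ι → Omega → ℝ} {S S' : Omega → ℝ} {A : Set Omega}
    (h : IsEssInfFam P ξ S) (h' : IsEssInfFam P ξ' S')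
    (he : ∀ a, ∀ᵐ ω ∂P, ω ∈ A → ξ a ω = ξ' a ω) : ∀ᵐ ω ∂P, ω ∈ A → S ω = S' ω := by
  filter_upwards [(isEssInfFam_iff_neg.1 h).ae_eq_on (isEssInfFam_iff_neg.1 h')
    fun a => (he a).mono fun ω hω hA => by simp [hω hA]] with ω hω hA
  simpa using hω hA

lemma IsEssSupFam.congr {ξ ξ' : ι → Omega → ℝ} {S : Omega → ℝ} (h : IsEssSupFam P ξ S)
    (he : ∀ a, ξ a =ᵐ[P] ξ' a) : IsEssSupFam P ξ' S :=
  ⟨fun a => (he a).symm.le.trans (h.1 a), fun W hW => h.2 W fun a => (he a).le.trans (hW a)⟩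

lemma IsEssInfFam.congr {ξ ξ' : ι → Omega → ℝ} {S : Omega → ℝ} (h : IsEssInfFam P ξ S)
    (he : ∀ a, ξ a =ᵐ[P] ξ' a) : IsEssInfFam P ξ' S :=
  ⟨fun a => (h.1 a).trans (he a).le, fun W hW => h.2 W fun a => (hW a).trans (he a).symm.le⟩

/-- Countably many members of the family can be pasted together along a partition in `𝓕_i`. -/
def HasPasting (P : Measure Omega) (i : ℕ) (ξ : ι → Omega → ℝ) : Prop :=
  ∀ (a : ℕ → ι) (κ : Omega → ℕ), Measurable[Fsig i] κ →
    ∃ b, ∀ k, ∀ᵐ ω ∂P, κ ω = k → ξ b ω = ξ (a k) ω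

lemma condExp_ae_eq_on {X Y : Omega → ℝ} (hX : Integrable X P) (hY : Integrable Y P)
    {A : Set Omega} (hA : MeasurableSet[Fsig i] A) (he : ∀ᵐ ω ∂P, ω ∈ A → X ω = Y ω) :
    ∀ᵐ ω ∂P, ω ∈ A → (P[X | Fsig i]) ω = (P[Y | Fsig i]) ω := by
  have h : A.indicator X =ᵐ[P] A.indicator Y := by
    filter_upwards [he] with ω hω
    by_cases hA : ω ∈ A
    · simp [hA, hω hA]
    · simp [hA]
  filter_upwards [condExp_indicator hX hA, condExp_indicator hY hA,
    condExp_congr_ae (m := Fsig i) h] with ω h1 h2 h3 hω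
  rw [h1, h2] at h3
  simpa [hω] using h3

/-- A bounded version of the conditional expectation. -/
lemma exists_bounded_condExp {X : Omega → ℝ} {C : ℝ} (h0 : 0 ≤ C) (hC : ∀ ω, |X ω| ≤ C) :
    ∃ Y : Omega → ℝ, Measurable[Fsig i] Y ∧ (∀ ω, |Y ω| ≤ C) ∧ Y =ᵐ[P] P[X | Fsig i] := by
  have hm : Measurable[Fsig i] (P[X | Fsig i]) := stronglyMeasurable_condExp.measurable
  refine ⟨fun ω => max (-C) (min C ((P[X | Fsig i]) ω)), measurable_const.max
    (measurable_const.min hm), fun ω => abs_le.2 ⟨le_max_left _ _, ?_⟩, ?_⟩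
  · exact max_le (by linarith) (min_le_left _ _)
  · filter_upwards [ae_bdd_abs_condExp_of_ae_bdd_abs (m := Fsig i) (ae_of_all P hC)]
      with ω hω
    have := abs_le.1 hω
    rw [min_eq_right this.2, max_eq_right this.1]

variable [IsProbabilityMeasure P]

lemma integrable_of_fsig_measurable {X : Omega → ℝ} {C : ℝ} (hX : Measurable[Fsig i] X)
    (hC : ∀ ω, |X ω| ≤ C) : Integrable X P :=
  Integrable.of_bound (C := C) (hX.mono (fsig_le i) le_rfl).aestronglyMeasurable
    (ae_of_all _ hC)

lemma abs_integral_le_of_abs_le {X : Omega → ℝ} {C : ℝ} (hC : ∀ ω, |X ω| ≤ C) :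
    |∫ ω, X ω ∂P| ≤ C := by
  simpa using norm_integral_le_of_norm_le_const (μ := P) (f := X) (C := C) (ae_of_all _ hC)

lemma HasPasting.integral_iSup_le {ξ : ι → Omega → ℝ} {C : ℝ} (hp : HasPasting P i ξ)
    (hm : ∀ a, Measurable[Fsig i] (ξ a)) (hC : ∀ a ω, |ξ a ω| ≤ C) (a : ℕ → ι) :
    Measurable[Fsig i] (fun ω => ⨆ n, ξ (a n) ω) ∧ (∀ ω, |⨆ n, ξ (a n) ω| ≤ C) ∧
      (∀ n ω, ξ (a n) ω ≤ ⨆ n, ξ (a n) ω) ∧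
      ∫ ω, ⨆ n, ξ (a n) ω ∂P ≤ ⨆ b, ∫ ω, ξ b ω ∂P := by
  classical
  have hbdd : ∀ ω, BddAbove (range fun n => ξ (a n) ω) := fun ω =>
    ⟨C, by rintro _ ⟨n, rfl⟩; exact (abs_le.1 (hC _ ω)).2⟩
  have hle : ∀ n ω, ξ (a n) ω ≤ ⨆ n, ξ (a n) ω := fun n ω => le_ciSup (hbdd ω) n
  have hS : Measurable[Fsig i] (fun ω => ⨆ n, ξ (a n) ω) := Measurable.iSup fun n => hm (a n)
  have hSC : ∀ ω, |⨆ n, ξ (a n) ω| ≤ C := fun ω => abs_le.2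
    ⟨(abs_le.1 (hC (a 0) ω)).1.trans (hle 0 ω), ciSup_le fun n => (abs_le.1 (hC _ ω)).2⟩
  refine ⟨hS, hSC, hle, le_of_forall_pos_le_add fun ε hε => ?_⟩
  have hex : ∀ ω, ∃ n, (⨆ n, ξ (a n) ω) - ε < ξ (a n) ω := fun ω =>
    exists_lt_of_lt_ciSup (by linarith)
  obtain ⟨b, hb⟩ := hp a (fun ω => Nat.find (hex ω))
    (measurable_find hex fun k => measurableSet_lt (hS.sub_const ε) (hm (a k)))
  have hint := integrable_of_fsig_measurable (P := P) (hm b) (hC b)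
  have h1 : ∫ ω, ⨆ n, ξ (a n) ω ∂P ≤ ∫ ω, (ξ b ω + ε) ∂P := by
    refine integral_mono_ae (integrable_of_fsig_measurable hS hSC)
      (hint.add (integrable_const ε)) ?_
    filter_upwards [ae_all_iff.2 hb] with ω hω
    have := Nat.find_spec (hex ω)
    rw [← hω _ rfl] at this
    linarith
  rw [integral_add hint (integrable_const ε)] at h1
  have h2 : ∫ ω, ξ b ω ∂P ≤ ⨆ b, ∫ ω, ξ b ω ∂P :=
    le_ciSup (f := fun b => ∫ ω, ξ b ω ∂P)
      ⟨C, by rintro _ ⟨c, rfl⟩; exact (abs_le.1 (abs_integral_le_of_abs_le (hC c))).2⟩ b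
  simp only [integral_const, probReal_univ, one_smul] at h1
  linarith

/-- A bounded family with the pasting property has an essential supremum, whose expectation is
the supremum of the expectations. -/
lemma HasPasting.exists_isEssSupFam [Nonempty ι] {ξ : ι → Omega → ℝ} {C : ℝ}
    (hp : HasPasting P i ξ) (hm : ∀ a, Measurable[Fsig i] (ξ a)) (hC : ∀ a ω, |ξ a ω| ≤ C) :
    ∃ S : Omega → ℝ, Measurable[Fsig i] S ∧ (∀ ω, |S ω| ≤ C) ∧ IsEssSupFam P ξ S ∧
      ∫ ω, S ω ∂P = ⨆ a, ∫ ω, ξ a ω ∂P := by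
  have hlt : ∀ n : ℕ, ∃ a, (⨆ a, ∫ ω, ξ a ω ∂P) - 1 / (n + 1) < ∫ ω, ξ a ω ∂P := fun n =>
    exists_lt_of_lt_ciSup (sub_lt_self _ Nat.one_div_pos_of_nat)
  choose a ha using hlt
  obtain ⟨hS, hSC, hle, hint⟩ := hp.integral_iSup_le hm hC a
  have hSint := integrable_of_fsig_measurable (P := P) hS hSC
  have heq : ∫ ω, ⨆ n, ξ (a n) ω ∂P = ⨆ a, ∫ ω, ξ a ω ∂P := by
    refine le_antisymm hint (le_of_tendsto' (f := fun n : ℕ =>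
      (⨆ a, ∫ ω, ξ a ω ∂P) - 1 / ((n : ℝ) + 1)) (x := atTop) ?_ fun n => ?_)
    · simpa using tendsto_const_nhds.sub (tendsto_one_div_add_atTop_nhds_zero_nat (𝕜 := ℝ))
    · exact (ha n).le.trans (integral_mono (integrable_of_fsig_measurable (hm _) (hC _)) hSint
        (hle n))
  refine ⟨_, hS, hSC, ⟨fun b => ?_, fun W hW => ?_⟩, heq⟩
  · let a' : ℕ → ι := fun n => Nat.casesOn n b a
    obtain ⟨hS', hSC', hle', hint'⟩ := hp.integral_iSup_le hm hC a'
    have hSS : ∀ ω, ⨆ n, ξ (a n) ω ≤ ⨆ n, ξ (a' n) ω := fun ω => ciSup_le fun n => hle' (n + 1) ω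
    have hS'int := integrable_of_fsig_measurable (P := P) hS' hSC'
    have h0 : (fun ω => ⨆ n, ξ (a n) ω) =ᵐ[P] fun ω => ⨆ n, ξ (a' n) ω :=
      (integral_eq_iff_of_ae_le hSint hS'int (ae_of_all _ hSS)).1
        (le_antisymm (integral_mono hSint hS'int hSS) (hint'.trans heq.ge))
    filter_upwards [h0] with ω hω
    rw [hω]
    exact hle' 0 ω
  · filter_upwards [ae_all_iff.2 fun n => hW (a n)] with ω hω using ciSup_le hω

/-- A bounded family with the pasting property has an essential infimum, whose expectation is
the infimum of the expectations. -/
lemma HasPasting.exists_isEssInfFam [Nonempty ι] {ξ : ι → Omega → ℝ} {C : ℝ}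
    (hp : HasPasting P i ξ) (hm : ∀ a, Measurable[Fsig i] (ξ a)) (hC : ∀ a ω, |ξ a ω| ≤ C) :
    ∃ S : Omega → ℝ, Measurable[Fsig i] S ∧ (∀ ω, |S ω| ≤ C) ∧ IsEssInfFam P ξ S ∧
      ∫ ω, S ω ∂P = ⨅ a, ∫ ω, ξ a ω ∂P := by
  have hp' : HasPasting P i fun a => -ξ a := fun a κ hκ => by
    obtain ⟨b, hb⟩ := hp a κ hκ
    exact ⟨b, fun k => (hb k).mono fun ω hω hk => by simp [hω hk]⟩
  obtain ⟨S, hS, hSC, hsup, hint⟩ := hp'.exists_isEssSupFam (C := C) (fun a => (hm a).neg)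
    fun a ω => by simpa using hC a ω
  refine ⟨-S, hS.neg, fun ω => by simpa using hSC ω, isEssInfFam_iff_neg.2 (by simpa), ?_⟩
  simp only [Pi.neg_apply, integral_neg, hint]
  rw [iInf, iSup, Real.sInf_def, ← Set.image_neg_eq_neg, ← range_comp]
  rfl

variable {A B : Type*} [Nonempty A] [Nonempty B]

/-- The expectation of an iterated essential supremum and infimum of conditional expectations. -/
lemma exists_essSup_essInf {φ : A → B → Omega → ℝ} {C : ℝ}
    (hφ : ∀ a b, Integrable (φ a b) P) (hC : ∀ a b ω, |φ a b ω| ≤ C)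
    (hA : ∀ (a : ℕ → A) (κ : Omega → ℕ), Measurable[Fsig i] κ →
      ∃ a', ∀ b k, ∀ᵐ ω ∂P, κ ω = k → φ a' b ω = φ (a k) b ω)
    (hB : ∀ (b : ℕ → B) (κ : Omega → ℕ), Measurable[Fsig i] κ →
      ∃ b', ∀ a k, ∀ᵐ ω ∂P, κ ω = k → φ a b' ω = φ a (b k) ω) :
    (∃ S J, (∀ a, IsEssInfFam P (fun b => P[φ a b | Fsig i]) (J a)) ∧ IsEssSupFam P J S ∧
      ∫ ω, S ω ∂P = ⨆ a, ⨅ b, ∫ ω, φ a b ω ∂P) ∧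
    ∃ S J, (∀ b, IsEssSupFam P (fun a => P[φ a b | Fsig i]) (J b)) ∧ IsEssInfFam P J S ∧
      ∫ ω, S ω ∂P = ⨅ b, ⨆ a, ∫ ω, φ a b ω ∂P := by
  inhabit A
  inhabit B
  have h0 : 0 ≤ C := (abs_nonneg _).trans (hC default default fun _ => 0)
  have hκm : ∀ (κ : Omega → ℕ) (k : ℕ), Measurable[Fsig i] κ →
      MeasurableSet[Fsig i] {ω | κ ω = k} := fun κ k hκ => hκ (measurableSet_singleton k)
  choose ξ hξm hξC hξ using fun a b =>
    exists_bounded_condExp (P := P) (i := i) (X := φ a b) h0 (hC a b)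
  have hξint : ∀ a b, ∫ ω, ξ a b ω ∂P = ∫ ω, φ a b ω ∂P := fun a b => by
    rw [integral_congr_ae (hξ a b), integral_condExp (fsig_le i)]
  have hloc : ∀ a b a' b' (D : Set Omega), MeasurableSet[Fsig i] D →
      (∀ᵐ ω ∂P, ω ∈ D → φ a b ω = φ a' b' ω) → ∀ᵐ ω ∂P, ω ∈ D → ξ a b ω = ξ a' b' ω := by
    intro a b a' b' D hD he
    filter_upwards [hξ a b, hξ a' b', condExp_ae_eq_on (hφ a b) (hφ a' b') hD he]
      with ω h1 h2 h3 hω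
    rw [h1, h2, h3 hω]
  have hpB : ∀ a, HasPasting P i (ξ a) := fun a b κ hκ => by
    obtain ⟨b', hb'⟩ := hB b κ hκ
    exact ⟨b', fun k => hloc _ _ _ _ {ω | κ ω = k} (hκm κ k hκ) (hb' a k)⟩
  have hpA : ∀ b, HasPasting P i fun a => ξ a b := fun b a κ hκ => by
    obtain ⟨a', ha'⟩ := hA a κ hκ
    exact ⟨a', fun k => hloc _ _ _ _ {ω | κ ω = k} (hκm κ k hκ) (ha' b k)⟩
  constructor
  · choose J hJm hJC hJ hJint using fun a => (hpB a).exists_isEssInfFam (hξm a) (hξC a)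
    have hpJ : HasPasting P i J := fun a κ hκ => by
      obtain ⟨a', ha'⟩ := hA a κ hκ
      exact ⟨a', fun k => (hJ a').ae_eq_on (A := {ω | κ ω = k}) (hJ (a k)) fun b =>
        hloc _ _ _ _ _ (hκm κ k hκ) (ha' b k)⟩
    obtain ⟨S, -, -, hS, hSint⟩ := hpJ.exists_isEssSupFam hJm hJC
    exact ⟨S, J, fun a => (hJ a).congr (hξ a), hS, by simp only [hSint, hJint, hξint]⟩
  · choose J hJm hJC hJ hJint using fun b =>
      (hpA b).exists_isEssSupFam (fun a => hξm a b) fun a => hξC a b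
    have hpJ : HasPasting P i J := fun b κ hκ => by
      obtain ⟨b', hb'⟩ := hB b κ hκ
      exact ⟨b', fun k => (hJ b').ae_eq_on (A := {ω | κ ω = k}) (hJ (b k)) fun a =>
        hloc _ _ _ _ _ (hκm κ k hκ) (hb' a k)⟩
    obtain ⟨S, -, -, hS, hSint⟩ := hpJ.exists_isEssInfFam hJm hJC
    exact ⟨S, J, fun b => (hJ b).congr fun a => hξ a b, hS, by simp only [hSint, hJint, hξint]⟩

end EssSup

/-! ### Strategies: locality, fixed points and pasting -/

section Strategies

/-- Admissible controls with respect to a sequence `M` of σ-fields; both players' admissible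
controls are of this form. -/
def Adm (M : ℕ → MeasurableSpace Omega) (X : Type) [MeasurableSpace X] {T : ℝ}
    (π : Partition T) : Set (ℝ → Omega → X) :=
  {u | Measurable (Function.uncurry u) ∧
    ∀ j < π.n, ∃ (Γ : ℕ → Set Omega) (w : ℕ → ℝ → Omega → X),
      (∀ k, MeasurableSet[Fsig j] (Γ k)) ∧
      Pairwise (Function.onFun Disjoint Γ) ∧
      (⋃ k, Γ k) = univ ∧
      (∀ k s, Measurable[M j] (w k s)) ∧
      (∀ k, ∀ ω ∈ Γ k, ∀ s ∈ Ico (π.t j) (π.t (j + 1)), u s ω = w k s ω)}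

/-- NAD strategies from admissible controls with respect to `N` to those with respect to `M`. -/
def IsNAD (M N : ℕ → MeasurableSpace Omega) {X Y : Type} [MeasurableSpace X] [MeasurableSpace Y]
    {T : ℝ} (P : Measure Omega) (π : Partition T) (t : ℝ)
    (α : (ℝ → Omega → Y) → (ℝ → Omega → X)) : Prop :=
  (∀ v ∈ Adm N Y π, α v ∈ Adm M X π) ∧
  ∀ τ : Omega → ℕ, IsStoppingIdx π τ →
    ∀ v v', v ∈ Adm N Y π → v' ∈ Adm N Y π →
      aeStEq P t (fun ω => π.t (τ ω)) v v' →
      aeStEq P t (fun ω => π.t (τ ω + 1)) (α v) (α v')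

variable {M N : ℕ → MeasurableSpace Omega} {X Y : Type} [MeasurableSpace X] [MeasurableSpace Y]
  {T t : ℝ} {P : Measure Omega} {π : Partition T} {i j : ℕ}

lemma fsig_mono (hij : i ≤ j) : Fsig i ≤ Fsig j := by
  refine Measurable.comap_le (Measurable.comp
    (g := fun (z : Fin j → I × I) (k : Fin i) => z (Fin.castLE hij k)) ?_
    (comap_measurable fun (ω : Omega) (k : Fin j) => ω (k : ℕ)))
  exact measurable_pi_lambda _ fun k => measurable_pi_apply _

lemma Partition.t_mono (π : Partition T) (hij : i ≤ j) (hj : j ≤ π.n) : π.t i ≤ π.t j := by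
  induction j, hij using Nat.le_induction with
  | base => exact le_rfl
  | succ k hk ih => exact (ih (by omega)).trans (π.mono k (by omega)).le

lemma Partition.idx_lt (π : Partition T) (s : ℝ) : π.idx s < π.n := by
  classical
  have := Nat.findGreatest_le (P := fun i => π.t i ≤ s) (π.n - 1)
  have := π.npos
  unfold Partition.idx
  omega

lemma Partition.t_idx_le (π : Partition T) {s : ℝ} (hs : 0 ≤ s) : π.t (π.idx s) ≤ s := by
  classical
  exact Nat.findGreatest_spec (P := fun i => π.t i ≤ s) (Nat.zero_le (π.n - 1))
    (by rwa [π.map_zero])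

lemma const_mem_adm (x : X) : (fun _ _ => x) ∈ Adm M X π := by
  refine ⟨measurable_const, fun j _ => ⟨fun k => {_ω | k = 0}, fun _ _ _ => x,
    fun k => MeasurableSet.const _, fun k l hkl => ?_, ?_, fun _ _ => measurable_const,
    fun _ _ _ _ _ => rfl⟩⟩
  · exact Set.disjoint_left.2 fun ω hk hl => hkl ((show k = 0 from hk).trans (show l = 0 from hl).symm)
  · exact eq_univ_of_forall fun ω => mem_iUnion.2 ⟨0, rfl⟩

lemma isNAD_const (x : X) : IsNAD M N P π t fun (_ : ℝ → Omega → Y) _ _ => x :=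
  ⟨fun _ _ => const_mem_adm x, fun _ _ _ _ _ _ _ => ae_of_all _ fun _ _ _ => rfl⟩

lemma ae_prod_fst_ne [SFinite P] (t : ℝ) : ∀ᵐ p ∂((volume : Measure ℝ).prod P), p.1 ≠ t :=
  Measure.quasiMeasurePreserving_fst.ae (Measure.ae_ne volume t)

/-- NAD strategies are local with respect to events in `𝓕_i` when `t_i ≤ t`. -/
lemma IsNAD.local [SFinite P] {α : (ℝ → Omega → Y) → (ℝ → Omega → X)}
    (hα : IsNAD M N P π t α) {A : Set Omega} (hA : MeasurableSet[Fsig i] A) (hit : π.t i ≤ t)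
    (hij : i ≤ j) (hj : j < π.n) {v v' : ℝ → Omega → Y} (hv : v ∈ Adm N Y π)
    (hv' : v' ∈ Adm N Y π)
    (h : ∀ᵐ p ∂((volume : Measure ℝ).prod P),
      p.2 ∈ A → t ≤ p.1 → p.1 ≤ π.t j → v p.1 p.2 = v' p.1 p.2) :
    ∀ᵐ p ∂((volume : Measure ℝ).prod P),
      p.2 ∈ A → t ≤ p.1 → p.1 ≤ π.t (j + 1) → α v p.1 p.2 = α v' p.1 p.2 := by
  classical
  have hτ : IsStoppingIdx π fun ω => if ω ∈ A then j else i := by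
    refine ⟨fun ω => by dsimp only; split_ifs <;> omega, fun l => ?_⟩
    by_cases hjl : j = l
    · subst hjl
      by_cases hil : i = j
      · simp [hil]
      · simpa [hil] using fsig_mono hij A hA
    · by_cases hil : i = l
      · subst hil
        have : {ω | (if ω ∈ A then j else i) = i} = Aᶜ := by
          ext ω; by_cases hω : ω ∈ A <;> simp [hω, hjl]
        rw [this]
        exact MeasurableSet.compl (m := Fsig i) hA
      · have : {ω | (if ω ∈ A then j else i) = l} = ∅ := by
          ext ω; by_cases hω : ω ∈ A <;> simp [hω, hjl, hil]
        rw [this]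
        exact @MeasurableSet.empty _ (Fsig l)
  have h1 : aeStEq P t (fun ω => π.t (if ω ∈ A then j else i)) v v' := by
    filter_upwards [h, ae_prod_fst_ne (P := P) t] with p hp hpt htp hpb
    by_cases hω : p.2 ∈ A
    · exact hp hω htp (by simpa [hω] using hpb)
    · simp only [hω, if_false] at hpb
      exact absurd (le_antisymm (hpb.trans hit) htp) hpt
  filter_upwards [hα.2 _ hτ v v' hv hv' h1] with p hp hω htp hpb
  exact hp htp (by simpa [hω] using hpb)

variable {α α' : (ℝ → Omega → Y) → (ℝ → Omega → X)} {β β' : (ℝ → Omega → X) → (ℝ → Omega → Y)}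

/-- Every couple of NAD strategies is associated with a couple of admissible controls. -/
lemma exists_fixed_pair [SFinite P] [Nonempty X] [Nonempty Y] (ht : 0 ≤ t)
    (hα : IsNAD M N P π t α) (hβ : IsNAD N M P π t β) :
    ∃ u ∈ Adm M X π, ∃ v ∈ Adm N Y π, aeEqIcc P t T (α v) u ∧ aeEqIcc P t T (β u) v := by
  inhabit X
  inhabit Y
  let z : ℕ → (ℝ → Omega → X) × (ℝ → Omega → Y) :=
    fun k => (fun q => (α q.2, β q.1))^[k] (fun _ _ => default, fun _ _ => default)
  have hz : ∀ k, z (k + 1) = (α (z k).2, β (z k).1) := fun k =>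
    Function.iterate_succ_apply' _ k _
  have hz1 : ∀ k, α (z k).2 = (z (k + 1)).1 := fun k => by rw [hz]
  have hz2 : ∀ k, β (z k).1 = (z (k + 1)).2 := fun k => by rw [hz]
  have hadm : ∀ k, (z k).1 ∈ Adm M X π ∧ (z k).2 ∈ Adm N Y π := by
    intro k
    induction k with
    | zero => exact ⟨const_mem_adm _, const_mem_adm _⟩
    | succ k ih => rw [hz]; exact ⟨hα.1 _ ih.2, hβ.1 _ ih.1⟩
  have h0 : π.t 0 ≤ t := by rwa [π.map_zero]
  have key : ∀ k ≤ π.n, (∀ᵐ p ∂((volume : Measure ℝ).prod P), p.2 ∈ (univ : Set Omega) →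
        t ≤ p.1 → p.1 ≤ π.t k → (z (k + 1)).1 p.1 p.2 = (z k).1 p.1 p.2) ∧
      (∀ᵐ p ∂((volume : Measure ℝ).prod P), p.2 ∈ (univ : Set Omega) →
        t ≤ p.1 → p.1 ≤ π.t k → (z (k + 1)).2 p.1 p.2 = (z k).2 p.1 p.2) := by
    intro k
    induction k with
    | zero =>
      refine fun _ => ⟨?_, ?_⟩ <;>
      · filter_upwards [ae_prod_fst_ne (P := P) t] with p hp _ h1 h2
        exact absurd (le_antisymm (h2.trans h0) h1) hp
    | succ k ih =>
      intro hk
      obtain ⟨h1, h2⟩ := ih (by omega)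
      have ha := hα.local (i := 0) MeasurableSet.univ h0 (Nat.zero_le k) hk (hadm _).2 (hadm _).2 h2
      have hb := hβ.local (i := 0) MeasurableSet.univ h0 (Nat.zero_le k) hk (hadm _).1 (hadm _).1 h1
      rw [hz1, hz1] at ha
      rw [hz2, hz2] at hb
      exact ⟨ha, hb⟩
  obtain ⟨h1, h2⟩ := key π.n le_rfl
  refine ⟨_, (hadm π.n).1, _, (hadm π.n).2, ?_, ?_⟩
  · filter_upwards [h1] with p hp hI
    rw [← hp (mem_univ _) hI.1 (hI.2.trans_eq π.map_last.symm), hz]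
  · filter_upwards [h2] with p hp hI
    rw [← hp (mem_univ _) hI.1 (hI.2.trans_eq π.map_last.symm), hz]

/-- The controls associated with a couple of strategies depend locally on the strategies. -/
lemma fixed_pair_local [SFinite P] (hα : IsNAD M N P π t α) (hβ : IsNAD N M P π t β)
    {A : Set Omega} (hA : MeasurableSet[Fsig i] A) (hit : π.t i ≤ t) (hi : i < π.n)
    {u u' : ℝ → Omega → X} {v v' : ℝ → Omega → Y}
    (hu : u ∈ Adm M X π) (hu' : u' ∈ Adm M X π) (hv : v ∈ Adm N Y π) (hv' : v' ∈ Adm N Y π)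
    (h1 : aeEqIcc P t T (α v) u) (h2 : aeEqIcc P t T (β u) v)
    (h1' : aeEqIcc P t T (α' v') u') (h2' : aeEqIcc P t T (β' u') v')
    (hαα : ∀ p : ℝ × Omega, p.2 ∈ A → t ≤ p.1 → α v' p.1 p.2 = α' v' p.1 p.2)
    (hββ : ∀ p : ℝ × Omega, p.2 ∈ A → t ≤ p.1 → β u' p.1 p.2 = β' u' p.1 p.2) :
    ∀ᵐ p ∂((volume : Measure ℝ).prod P), p.2 ∈ A → p.1 ∈ Icc t T →
      u p.1 p.2 = u' p.1 p.2 ∧ v p.1 p.2 = v' p.1 p.2 := by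
  have key : ∀ k, i ≤ k → k ≤ π.n → (∀ᵐ p ∂((volume : Measure ℝ).prod P), p.2 ∈ A →
        t ≤ p.1 → p.1 ≤ π.t k → u p.1 p.2 = u' p.1 p.2) ∧
      (∀ᵐ p ∂((volume : Measure ℝ).prod P), p.2 ∈ A →
        t ≤ p.1 → p.1 ≤ π.t k → v p.1 p.2 = v' p.1 p.2) := by
    intro k hik
    induction k, hik using Nat.le_induction with
    | base =>
      refine fun _ => ⟨?_, ?_⟩ <;>
      · filter_upwards [ae_prod_fst_ne (P := P) t] with p hp _ h1 h2
        exact absurd (le_antisymm (h2.trans hit) h1) hp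
    | succ k hik ih =>
      intro hk
      obtain ⟨hU, hV⟩ := ih (by omega)
      have hT : π.t (k + 1) ≤ T := (π.t_mono hk le_rfl).trans_eq π.map_last
      constructor
      · filter_upwards [hα.local hA hit hik hk hv hv' hV, h1, h1'] with p e0 e1 e2 hω hp hpk
        rw [← e1 ⟨hp, hpk.trans hT⟩, ← e2 ⟨hp, hpk.trans hT⟩, e0 hω hp hpk, hαα p hω hp]
      · filter_upwards [hβ.local hA hit hik hk hu hu' hU, h2, h2'] with p e0 e1 e2 hω hp hpk
        rw [← e1 ⟨hp, hpk.trans hT⟩, ← e2 ⟨hp, hpk.trans hT⟩, e0 hω hp hpk, hββ p hω hp]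
  obtain ⟨hU, hV⟩ := key π.n hi.le le_rfl
  filter_upwards [hU, hV] with p e1 e2 hω hp
  have := hp.2
  rw [← π.map_last] at this
  exact ⟨e1 hω hp.1 this, e2 hω hp.1 this⟩

/-- Pasting of countably many NAD strategies along a partition in `𝓕_i`, where `t_i ≤ t`. -/
lemma exists_pasted_strategy [Nonempty X] (hit : π.t i ≤ t) (hi : i ≤ π.n)
    {a : ℕ → (ℝ → Omega → Y) → (ℝ → Omega → X)} (ha : ∀ k, IsNAD M N P π t (a k))
    {κ : Omega → ℕ} (hκ : Measurable[Fsig i] κ) :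
    ∃ α, IsNAD M N P π t α ∧ ∀ v (p : ℝ × Omega), t ≤ p.1 →
      α v p.1 p.2 = a (κ p.2) v p.1 p.2 := by
  classical
  inhabit X
  refine ⟨fun v s ω => if s < π.t i then default else a (κ ω) v s ω, ⟨fun v hv => ⟨?_, ?_⟩, ?_⟩,
    fun v p hp => if_neg (not_lt.2 (hit.trans hp))⟩
  · refine Measurable.ite (measurableSet_lt measurable_fst measurable_const) measurable_const ?_
    have h1 : Measurable fun q : ℕ × (ℝ × Omega) => a q.1 v q.2.1 q.2.2 :=
      measurable_from_prod_countable_right fun k => ((ha k).1 v hv).1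
    exact h1.comp (((hκ.mono (fsig_le i) le_rfl).comp measurable_snd).prodMk measurable_id)
  · intro j hj
    by_cases hji : j < i
    · obtain ⟨Γ, w, h1, h2, h3, h4, h5⟩ := (const_mem_adm (M := M) (π := π) (default : X)).2 j hj
      refine ⟨Γ, w, h1, h2, h3, h4, fun k ω hω s hs => ?_⟩
      rw [← h5 k ω hω s hs]
      exact if_pos (hs.2.trans_le (π.t_mono hji hi))
    · have hij : i ≤ j := not_lt.1 hji
      choose Γ w h1 h2 h3 h4 h5 using fun k => ((ha k).1 v hv).2 j hj
      refine ⟨fun m => {ω | κ ω = m.unpair.1} ∩ Γ m.unpair.1 m.unpair.2,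
        fun m => w m.unpair.1 m.unpair.2, fun m => ?_, fun m m' hmm => ?_, ?_, fun m => h4 _ _,
        fun m ω hω s hs => ?_⟩
      · exact MeasurableSet.inter (m := Fsig j)
          (fsig_mono hij _ (hκ (measurableSet_singleton m.unpair.1))) (h1 _ _)
      · refine Set.disjoint_left.2 fun ω hω hω' => hmm ?_
        have e1 : m.unpair.1 = m'.unpair.1 := hω.1.symm.trans hω'.1
        have e2 : m.unpair.2 = m'.unpair.2 := by
          by_contra hne
          exact Set.disjoint_left.1 (h2 _ hne) hω.2 (e1 ▸ hω'.2)
        rw [← Nat.pair_unpair m, ← Nat.pair_unpair m', e1, e2]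
      · refine eq_univ_of_forall fun ω => ?_
        obtain ⟨l, hl⟩ := mem_iUnion.1 (h3 (κ ω) ▸ mem_univ ω)
        exact mem_iUnion.2 ⟨Nat.pair (κ ω) l, by simpa using hl⟩
      · have hk : κ ω = m.unpair.1 := hω.1
        change (if s < π.t i then default else a (κ ω) v s ω) =
          w m.unpair.1 m.unpair.2 s ω
        rw [if_neg (not_lt.2 ((π.t_mono hij hj.le).trans hs.1)), hk]
        exact h5 _ _ ω hω.2 s hs
  · intro τ hτ v v' hv hv' h
    filter_upwards [ae_all_iff.2 fun k => (ha k).2 τ hτ v v' hv hv' h] with p hp h1 h2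
    simp only [hp (κ p.2) h1 h2]

end Strategies

/-! ### Locality of the pay-off and uniqueness of the value functions -/

section Payoff

variable {U V : Type} [MeasurableSpace U] [MeasurableSpace V] [Nonempty U] [Nonempty V]
  {T t : ℝ} {P : Measure Omega} {π : Partition T} {i : ℕ}
  {f : ℝ → EuclideanSpace ℝ (Fin d) → U → V → EuclideanSpace ℝ (Fin d)}
  {g : EuclideanSpace ℝ (Fin d) → ℝ} {x : EuclideanSpace ℝ (Fin d)}
  {α α' : (ℝ → Omega → V) → (ℝ → Omega → U)} {β β' : (ℝ → Omega → U) → (ℝ → Omega → V)}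

lemma ae_eq_of_isLowerVal {S S' : Omega → ℝ} (h : IsLowerVal U V f g P π t x S)
    (h' : IsLowerVal U V f g P π t x S') : S =ᵐ[P] S' := by
  obtain ⟨J, hJ, hS⟩ := h
  obtain ⟨J', hJ', hS'⟩ := h'
  filter_upwards [hS.ae_eq_on (A := univ) hS' fun a => (hJ a).ae_eq_on (hJ' a) fun b =>
    ae_of_all _ fun _ _ => rfl] with ω hω using hω (mem_univ ω)

lemma ae_eq_of_isUpperVal {S S' : Omega → ℝ} (h : IsUpperVal U V f g P π t x S)
    (h' : IsUpperVal U V f g P π t x S') : S =ᵐ[P] S' := by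
  obtain ⟨J, hJ, hS⟩ := h
  obtain ⟨J', hJ', hS'⟩ := h'
  filter_upwards [hS.ae_eq_on (A := univ) hS' fun b => (hJ b).ae_eq_on (hJ' b) fun a =>
    ae_of_all _ fun _ _ => rfl] with ω hω using hω (mem_univ ω)

variable [IsProbabilityMeasure P]

lemma isFixPair_fixPair (ht : 0 ≤ t) (hα : IsNAD1 U V P π t α) (hβ : IsNAD2 U V P π t β) :
    IsFixPair P π t T α β (fixPair P π t T α β).1 (fixPair P π t T α β).2 := by
  obtain ⟨u, hu, v, hv, h1, h2⟩ := exists_fixed_pair (M := Gsig) (N := Hsig) ht hα hβ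
  exact Classical.epsilon_spec (p := fun p : (ℝ → Omega → U) × (ℝ → Omega → V) =>
    IsFixPair P π t T α β p.1 p.2) ⟨(u, v), hu, hv, h1, h2⟩

/-- The pay-off depends locally on the strategies. -/
lemma payoff_local (ht : 0 ≤ t) (hα : IsNAD1 U V P π t α) (hβ : IsNAD2 U V P π t β)
    (hα' : IsNAD1 U V P π t α') (hβ' : IsNAD2 U V P π t β')
    {A : Set Omega} (hA : MeasurableSet[Fsig i] A) (hit : π.t i ≤ t) (hi : i < π.n)
    (hαα : ∀ v (p : ℝ × Omega), p.2 ∈ A → t ≤ p.1 → α v p.1 p.2 = α' v p.1 p.2)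
    (hββ : ∀ u (p : ℝ × Omega), p.2 ∈ A → t ≤ p.1 → β u p.1 p.2 = β' u p.1 p.2) :
    ∀ᵐ ω ∂P, ω ∈ A → payoff f g P π t x α β ω = payoff f g P π t x α' β' ω := by
  obtain ⟨hu, hv, h1, h2⟩ := isFixPair_fixPair ht hα hβ
  obtain ⟨hu', hv', h1', h2'⟩ := isFixPair_fixPair ht hα' hβ'
  have h := fixed_pair_local (M := Gsig) (N := Hsig) hα hβ hA hit hi hu hu' hv hv' h1 h2 h1' h2'
    (hαα _) (hββ _)
  have hswap := (Measure.measurePreserving_swap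
    (μ := P) (ν := (volume : Measure ℝ))).quasiMeasurePreserving.ae h
  filter_upwards [Measure.ae_ae_of_ae_prod hswap] with ω hω hωA
  simp only [payoff, solStrat]
  rw [sol_congr]
  filter_upwards [hω] with s hs hsI using hs hωA hsI

end Payoff

/-- **Theorem 3.3.** For every partition `Π` and all `(t,x) ∈ [0,T] × ℝ^d`, the
(almost surely constant) value functions satisfy
`V^Π(t,x) = sup_α inf_β E[g(X_T^{t,x,α,β})]` and `U^Π(t,x) = inf_β sup_α E[g(X_T^{t,x,α,β})]`. -/
theorem statement_9
    {d : ℕ} {U V : Type} [MetricSpace U] [CompactSpace U] [MetricSpace V] [CompactSpace V]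
    [MeasurableSpace U] [BorelSpace U] [MeasurableSpace V] [BorelSpace V]
    [Nonempty U] [Nonempty V]
    (T : ℝ) (hT : 0 < T)
    (f : ℝ → EuclideanSpace ℝ (Fin d) → U → V → EuclideanSpace ℝ (Fin d))
    (hf_bdd : ∃ C : ℝ, ∀ t x u v, ‖f t x u v‖ ≤ C)
    (hf_cont : ContinuousOn
      (fun q : ℝ × EuclideanSpace ℝ (Fin d) × U × V => f q.1 q.2.1 q.2.2.1 q.2.2.2)
      (Icc (0 : ℝ) T ×ˢ univ))
    (hf_lip : ∃ K : ℝ≥0, ∀ t u v, LipschitzWith K fun x => f t x u v)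
    (g : EuclideanSpace ℝ (Fin d) → ℝ)
    (hg_bdd : ∃ C : ℝ, ∀ x, |g x| ≤ C)
    (hg_lip : ∃ K : ℝ≥0, LipschitzWith K g)
    (P : Measure Omega) [IsProbabilityMeasure P] (hP : IsProductMeasure P)
    (π : Partition T) (t : ℝ) (ht : t ∈ Icc (0 : ℝ) T) (x : EuclideanSpace ℝ (Fin d)) :
    (lowerValD U V f g P π t x
      = ⨆ α : {α // IsNAD1 U V P π t α}, ⨅ β : {β // IsNAD2 U V P π t β},
          ∫ ω, payoff f g P π t x α.1 β.1 ω ∂P) ∧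
    (upperValD U V f g P π t x
      = ⨅ β : {β // IsNAD2 U V P π t β}, ⨆ α : {α // IsNAD1 U V P π t α},
          ∫ ω, payoff f g P π t x α.1 β.1 ω ∂P) := by
  obtain ⟨C, hC⟩ := hf_bdd
  obtain ⟨K, hK⟩ := hf_lip
  obtain ⟨D, hD⟩ := hg_bdd
  obtain ⟨L, hL⟩ := hg_lip
  have hit := π.t_idx_le ht.1
  have hi := π.idx_lt t
  have : Nonempty {α // IsNAD1 U V P π t α} :=
    ⟨⟨_, isNAD_const (M := Gsig) (N := Hsig) (Classical.arbitrary U)⟩⟩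
  have : Nonempty {β // IsNAD2 U V P π t β} :=
    ⟨⟨_, isNAD_const (M := Hsig) (N := Gsig) (Classical.arbitrary V)⟩⟩
  have hint : ∀ (α : {α // IsNAD1 U V P π t α}) (β : {β // IsNAD2 U V P π t β}),
      Integrable (payoff f g P π t x α.1 β.1) P := fun α β => by
    obtain ⟨hu, hv, -, -⟩ := isFixPair_fixPair ht.1 α.2 β.2
    exact Integrable.of_bound (C := D) (hL.continuous.measurable.comp
      (measurable_sol hT.le hC hf_cont hK ht x hu.1 hv.1)).aestronglyMeasurable
      (ae_of_all _ fun ω => hD _)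
  obtain ⟨⟨S, J, hJ, hS, hSint⟩, S', J', hJ', hS', hSint'⟩ := exists_essSup_essInf (P := P)
    (i := π.idx t) (A := {α // IsNAD1 U V P π t α}) (B := {β // IsNAD2 U V P π t β})
    (φ := fun α β => payoff f g P π t x α.1 β.1) (C := D) hint (fun _ _ _ => hD _)
    (fun a κ hκ => by
      obtain ⟨α, hα, hακ⟩ := exists_pasted_strategy (M := Gsig) (N := Hsig) hit hi.le
        (fun k => (a k).2) hκ
      exact ⟨⟨α, hα⟩, fun β k => payoff_local ht.1 hα β.2 (a k).2 β.2 (A := {ω | κ ω = k})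
        (hκ (measurableSet_singleton k)) hit hi
        (fun v p hp htp => by rw [hακ v p htp, show κ p.2 = k from hp]) fun _ _ _ _ => rfl⟩)
    (fun b κ hκ => by
      obtain ⟨β, hβ, hβκ⟩ := exists_pasted_strategy (M := Hsig) (N := Gsig) hit hi.le
        (fun k => (b k).2) hκ
      exact ⟨⟨β, hβ⟩, fun α k => payoff_local ht.1 α.2 hβ α.2 (b k).2 (A := {ω | κ ω = k})
        (hκ (measurableSet_singleton k)) hit hi (fun _ _ _ _ => rfl)
        fun u p hp htp => by rw [hβκ u p htp, show κ p.2 = k from hp]⟩)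
  have hlow : IsLowerVal U V f g P π t x S := ⟨J, hJ, hS⟩
  have hupp : IsUpperVal U V f g P π t x S' := ⟨J', hJ', hS'⟩
  constructor
  · rw [← hSint]
    exact integral_congr_ae (ae_eq_of_isLowerVal (Classical.epsilon_spec ⟨S, hlow⟩) hlow)
  · rw [← hSint']
    exact integral_congr_ae (ae_eq_of_isUpperVal (Classical.epsilon_spec ⟨S', hupp⟩) hupp)

end DGameFormal
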